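/- Let p ≡ 3 (mod 4), let e = 2m with m ≥ 1, and suppose s divides m and m/s ≡ 1 (mod 2). Then for i = 0, 1 and a, b ∈ F_q: (1) if a = 0 and b = 0, then T_i(a,b) = ((p-1)/2)(p^{2e-2} + p^{e+m-2}); (2) if a = 0 and b ∈ F_p^*, then T_i(a,b) = 0; (3) if a = 0 and b ∈ F_q^* \ F_p^*, then T_i(a,b) = ((p-1)/2)(p^{2e-3} + p^{e+m-3}); (4) if a ≠ 0 and b = 0, then the equation X^{p^{2l}} + X = -a^{p^l} has a unique solution γ in F_q and T_i(a,b) = ((p-1)/2)(p^{2e-3} + p^{e+m-2}) if Tr(γ^{p^l+1}) = 0 or Tr(γ^{p^l+1}) ∈ C_0^{(2,p)}, while T_i(a,b) = ((p-1)/2)(p^{2e-3} - p^{e+m-2}) if Tr(γ^{p^l+1}) ∈ C_1^{(2,p)}; (5) if a ≠ 0 and b ∈ F_p^*, then with γ as in (4), T_i(a,b) = ((p-1)/2) p^{2e-3} if Tr(γ^{p^l+1}) = 0 or Tr(γ^{p^l+1}) ∈ C_0^{(2,p)}, while T_i(a,b) = ((p-1)/2) p^{2e-3} + p^{e+m-2}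 if Tr(γ^{p^l+1}) ∈ C_1^{(2,p)}; (6) if a ≠ 0 and b ∈ F_q^* \ F_p^*, then T_i(a,b) = ((p-1)/2)(p^{2e-3} + p^{e+m-3}). -/

import Mathlib

open scoped BigOperators

noncomputable section

/-- The primitive `p`-th root of unity `ζ_p = exp(2πi/p)`. -/
def zetaP (p : ℕ) : ℂ := Complex.exp (2 * Real.pi * Complex.I / p)

/-- The absolute trace map from `F_q = GF(p^e)` onto `F_p`. -/
def tr (p e : ℕ) [Fact p.Prime] (x : GaloisField p e) : ZMod p :=
  Algebra.trace (ZMod p) (GaloisField p e) x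

/-- The Weil sum `S(α, β) = Σ_{x ∈ F_q} ζ_p^{Tr(α x^{p^l+1} + β x)}`. -/
def weilSum (p e l : ℕ) [Fact p.Prime] (α β : GaloisField p e) : ℂ :=
  letI : Fintype (GaloisField p e) := Fintype.ofFinite _
  ∑ x : GaloisField p e, zetaP p ^ (tr p e (α * x ^ (p ^ l + 1) + β * x)).val

/- The quadratic character `η` of `F_p`, integer-valued:
`η(0) = 0`, `η(x) = 1` for nonzero squares, `η(x) = -1` for nonsquares. -/
open Classical in
def eta (p : ℕ) (x : ZMod p) : ℤ :=
  if x = 0 then 0 else if IsSquare x then 1 else -1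

/- The cyclotomic classes of order 2 in `F_p^*`: `cyc p 0` is the set of nonzero
squares `C_0^{(2,p)}`, and `cyc p 1` is the set of nonsquares `C_1^{(2,p)}`. -/
open Classical in
def cyc (p : ℕ) [Fact p.Prime] (i : ℕ) : Finset (ZMod p) :=
  Finset.univ.filter (fun x => x ≠ 0 ∧ (if i = 0 then IsSquare x else ¬ IsSquare x))

/-- `ψ_3(a) = ((p-1)/2) p^{e-3} Σ_{z1 ∈ F_p^*} ζ_p^{-z1} Σ_{z3 ∈ F_p^*} S(z1, a z3)`. -/
def psi3 (p e l : ℕ) [Fact p.Prime] (a : GaloisField p e) : ℂ :=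
  ((p : ℂ) - 1) / 2 * (p : ℂ) ^ ((e : ℤ) - 3) *
    ∑ z1 ∈ ({0}ᶜ : Finset (ZMod p)), zetaP p ^ (-z1).val *
      ∑ z3 ∈ ({0}ᶜ : Finset (ZMod p)),
        weilSum p e l (algebraMap (ZMod p) (GaloisField p e) z1)
          (a * algebraMap (ZMod p) (GaloisField p e) z3)

/-- `ψ_4^{(i)}(a, b) = p^{e-3} Σ_{c ∈ C_i} Σ_{z1 ∈ F_p^*} ζ_p^{-z1}
      Σ_{z2 ∈ F_p^*} ζ_p^{-c z2} S(z1, -a b⁻¹ z2)`, for `b ∈ F_p^*`. -/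
def psi4 (p e l : ℕ) [Fact p.Prime] (i : ℕ) (a : GaloisField p e) (b : ZMod p) : ℂ :=
  (p : ℂ) ^ ((e : ℤ) - 3) *
    ∑ c ∈ cyc p i, ∑ z1 ∈ ({0}ᶜ : Finset (ZMod p)), zetaP p ^ (-z1).val *
      ∑ z2 ∈ ({0}ᶜ : Finset (ZMod p)), zetaP p ^ (-(c * z2)).val *
        weilSum p e l (algebraMap (ZMod p) (GaloisField p e) z1)
          (-a * algebraMap (ZMod p) (GaloisField p e) (b⁻¹ * z2))

/-- `T_i(a,b) = |{(x1,x2) ∈ F_q² : Tr(x1^{p^l+1}) = 1, Tr(x2) ∈ C_i, Tr(a x1 + b x2) = 0}|`. -/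
def Tcount (p e l : ℕ) [Fact p.Prime] (i : ℕ) (a b : GaloisField p e) : ℕ :=
  Nat.card {x : GaloisField p e × GaloisField p e //
    tr p e (x.1 ^ (p ^ l + 1)) = 1 ∧ tr p e x.2 ∈ cyc p i ∧ tr p e (a * x.1 + b * x.2) = 0}

/-- The defining set `D_i = {(x1,x2) ∈ F_q² : Tr(x1^{p^l+1}) = 1, Tr(x2) ∈ C_i^{(2,p)}}`. -/
def Dset (p e l : ℕ) [Fact p.Prime] (i : ℕ) : Set (GaloisField p e × GaloisField p e) :=
  {x | tr p e (x.1 ^ (p ^ l + 1)) = 1 ∧ tr p e x.2 ∈ cyc p i}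

/-- The codeword of `C_{D_i}` indexed by `(a, b) ∈ F_q²`:
the vector `(Tr(a x1 + b x2))_{(x1,x2) ∈ D_i}`. -/
def codeword (p e l : ℕ) [Fact p.Prime] (i : ℕ) (a b : GaloisField p e) :
    Dset p e l i → ZMod p :=
  fun x => tr p e (a * x.1.1 + b * x.1.2)

/-- The linear code `C_{D_i} = {(Tr(a x1 + b x2))_{(x1,x2) ∈ D_i} : a, b ∈ F_q}`. -/
def code (p e l : ℕ) [Fact p.Prime] (i : ℕ) : Set (Dset p e l i → ZMod p) :=
  Set.range (fun ab : GaloisField p e × GaloisField p e => codeword p e l i ab.1 ab.2)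

/-- The Hamming weight of a vector: the number of nonzero coordinates. -/
def wt {ι : Type*} {p : ℕ} (c : ι → ZMod p) : ℕ := Nat.card {x : ι // c x ≠ 0}

section helpers
/-- number of elements satisfying a predicate, as a rational number. -/
def cnt {A : Type*} (P : A → Prop) : ℚ := (Nat.card {x // P x} : ℚ)

open Classical in
theorem cnt_eq_sum {A : Type*} [Fintype A] (P : A → Prop) :
    cnt P = ∑ x, if P x then (1 : ℚ) else 0 := by
  simp [cnt, Nat.card_eq_fintype_card, Fintype.card_subtype]

theorem cnt_congr {A : Type*} {P R : A → Prop} (h : ∀ x, P x ↔ R x) : cnt P = cnt R := by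
  have : P = R := funext fun x => propext (h x)
  rw [this]

theorem cnt_equiv {A B : Type*} {P : A → Prop} {R : B → Prop} (σ : A ≃ B)
    (h : ∀ x, P x ↔ R (σ x)) : cnt P = cnt R := by
  unfold cnt
  rw [Nat.card_congr (σ.subtypeEquiv h)]

theorem cnt_prod {A B : Type*} [Fintype A] [Fintype B] (P : A × B → Prop) :
    cnt P = ∑ a, cnt (fun b => P (a, b)) := by
  classical
  simp only [cnt_eq_sum, Fintype.sum_prod_type]

theorem cnt_prod_right {A B : Type*} [Fintype A] [Fintype B] (P : A × B → Prop) :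
    cnt P = ∑ b, cnt (fun a => P (a, b)) := by
  classical
  simp only [cnt_eq_sum, Fintype.sum_prod_type_right]

theorem cnt_fib {A B : Type*} [Fintype A] [Fintype B] (f : A → B) (P : A → Prop) :
    cnt P = ∑ b, cnt (fun a => P a ∧ f a = b) := by
  classical
  simp only [cnt_eq_sum]
  rw [Finset.sum_comm]
  refine Finset.sum_congr rfl fun x _ => ?_
  by_cases h : P x <;> simp [h]

/-- summing a function of `f` over `A`. -/
theorem sum_fib {A B : Type*} [Fintype A] [Fintype B] (f : A → B) (P : A → Prop) (g : B → ℚ) :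
    cnt P = cnt P ∧ ∑ a, g (f a) = ∑ b, cnt (fun a => f a = b) * g b := by
  classical
  refine ⟨rfl, ?_⟩
  simp only [cnt_eq_sum, Finset.sum_mul]
  rw [Finset.sum_comm]
  refine Finset.sum_congr rfl fun x _ => ?_
  simp

theorem cnt_true {A : Type*} [Fintype A] : cnt (fun _ : A => True) = Fintype.card A := by
  simp [cnt_eq_sum]

theorem cnt_false {A : Type*} [Fintype A] {P : A → Prop} (h : ∀ x, ¬ P x) : cnt P = 0 := by
  simp [cnt_eq_sum, h]

theorem cnt_single {A : Type*} (a : A) : cnt (fun x => x = a) = 1 := by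
  simp [cnt]

theorem cnt_not {A : Type*} [Fintype A] (P : A → Prop) :
    cnt (fun x => ¬ P x) = Fintype.card A - cnt P := by
  classical
  have : cnt (fun x => ¬ P x) + cnt P = Fintype.card A := by
    simp only [cnt_eq_sum, ← Finset.sum_add_distrib]
    rw [← cnt_true, cnt_eq_sum]
    refine Finset.sum_congr rfl fun x _ => ?_
    by_cases h : P x <;> simp [h]
  linarith

theorem cnt_and_not {A : Type*} [Fintype A] (P R : A → Prop) :
    cnt P = cnt (fun x => P x ∧ R x) + cnt (fun x => P x ∧ ¬ R x) := by
  classical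
  simp only [cnt_eq_sum, ← Finset.sum_add_distrib]
  refine Finset.sum_congr rfl fun x _ => ?_
  by_cases h : P x <;> by_cases h' : R x <;> simp [h, h']

theorem cnt_hom {A B : Type*} [AddCommGroup A] [AddCommGroup B] [Fintype A] [Fintype B]
    (f : A →+ B) (hf : Function.Surjective f) (b : B) :
    cnt (fun x => f x = b) = (Fintype.card A : ℚ) / Fintype.card B := by
  have key : ∀ c, cnt (fun x => f x = c) = cnt (fun x => f x = b) := by
    intro c
    obtain ⟨y, hy⟩ := hf (b - c)
    refine cnt_equiv (Equiv.addRight y) fun x => ?_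
    simp only [Equiv.coe_addRight, map_add, hy]
    constructor
    · rintro rfl; abel
    · intro h; have := congrArg (· - (b - c)) h; simpa using this
  have h := cnt_fib f (fun _ => True)
  rw [cnt_true] at h
  simp only [true_and, key] at h
  rw [Finset.sum_const, Finset.card_univ, nsmul_eq_mul] at h
  have : (Fintype.card B : ℚ) ≠ 0 := by
    simp
  field_simp
  rw [h]; ring

set_option linter.unusedSectionVars false
variable {p : ℕ} [Fact p.Prime]

theorem sum_off (g : ZMod p → ℚ) (hg : ∀ c, c ≠ 0 → g c = g 1) :
    ∑ c, g c = g 0 + (p - 1) * g 1 := by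
  classical
  rw [← Finset.add_sum_erase _ _ (Finset.mem_univ (0 : ZMod p))]
  rw [Finset.sum_congr rfl (g := fun _ => g 1)
    (fun x hx => hg x (Finset.ne_of_mem_erase hx))]
  have h1 : 1 ≤ p := (Fact.out : p.Prime).one_lt.le
  simp [Finset.card_erase_of_mem, ZMod.card, Nat.cast_sub h1]

theorem quad_D {V : Type*} [AddCommGroup V] [Fintype V] (Q : V → ZMod p)
    (B : V → (V →+ ZMod p)) (hQ : ∀ u v, Q (u + v) = Q u + Q v + B v u)
    (hB0 : B 0 = 0) (hQ0 : Q 0 = 0)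
    (hB : ∀ v, v ≠ 0 → Function.Surjective (B v))
    (hs : ∀ c, c ≠ 0 → cnt (fun x => Q x = c) = cnt (fun x => Q x = 1)) :
    (cnt (fun x => Q x = 0) - cnt (fun x => Q x = 1)) ^ 2 = Fintype.card V := by
  classical
  have hp0 : (p : ℚ) ≠ 0 := by exact_mod_cast (Fact.out : p.Prime).ne_zero
  have h1 : (Fintype.card V : ℚ) = cnt (fun x => Q x = 0) + (p - 1) * cnt (fun x => Q x = 1) := by
    rw [← cnt_true, cnt_fib Q]
    simp only [true_and]
    exact sum_off (fun c => cnt (fun x => Q x = c)) hs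
  have h2 : cnt (fun z : V × V => Q z.2 = Q z.1) =
      cnt (fun x => Q x = 0) ^ 2 + (p - 1) * cnt (fun x => Q x = 1) ^ 2 := by
    rw [cnt_prod]
    rw [(sum_fib Q (fun _ => True) (fun c => cnt (fun x => Q x = c))).2]
    rw [sum_off (fun c => cnt (fun a => Q a = c) * cnt (fun a => Q a = c))]
    · ring
    · intro c hc; simp only [hs c hc]
  have h3 : cnt (fun z : V × V => Q z.2 = Q z.1) =
      Fintype.card V + (Fintype.card V - 1) * ((Fintype.card V : ℚ) / p) := by
    have : cnt (fun z : V × V => Q z.2 = Q z.1) = cnt (fun z : V × V => B z.2 z.1 = - Q z.2) := by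
      symm
      refine cnt_equiv (⟨fun z => (z.1, z.1 + z.2), fun z => (z.1, z.2 - z.1),
        fun z => by simp, fun z => by simp⟩ : V × V ≃ V × V) fun z => ?_
      simp only [Equiv.coe_fn_mk, hQ]
      constructor
      · intro h; rw [h]; ring
      · intro h; linear_combination h
    rw [this, cnt_prod_right, ← Finset.add_sum_erase _ _ (Finset.mem_univ (0 : V))]
    simp only [hB0, hQ0, neg_zero, AddMonoidHom.zero_apply]
    rw [cnt_true]
    rw [Finset.sum_congr rfl (g := fun _ => (Fintype.card V : ℚ) / p)]
    · have : 1 ≤ Fintype.card V := Fintype.card_pos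
      simp [Finset.card_erase_of_mem, Nat.cast_sub this]
    · intro v hv
      rw [cnt_hom (B v) (hB v (Finset.ne_of_mem_erase hv)), ZMod.card]
  rw [h2] at h3
  generalize cnt (fun x => Q x = 0) = n0 at *
  generalize cnt (fun x => Q x = 1) = n1 at *
  rw [h1] at h3 ⊢
  have hp1 : (p : ℚ) - 1 ≠ 0 := by
    have := (Fact.out : p.Prime).one_lt
    have : (1 : ℚ) < p := by exact_mod_cast this
    linarith
  field_simp at h3
  have : ((p : ℚ) - 1) * ((n0 - n1) ^ 2 - (n0 + (p - 1) * n1)) = 0 := by linear_combination h3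
  have := (mul_eq_zero.1 this).resolve_left hp1
  linarith

theorem quad_h {V : Type*} [AddCommGroup V] [Module (ZMod p) V] [Fintype V] (Q : V → ZMod p)
    (B : V → (V →+ ZMod p)) (hQ : ∀ u v, Q (u + v) = Q u + Q v + B v u)
    (hBs : ∀ v (j : ZMod p) u, B (j • v) u = j * B v u)
    (hQs : ∀ v (j : ZMod p), Q (j • v) = j ^ 2 * Q v)
    (γ : V) (hB : Function.Surjective (B γ))
    (hs : ∀ c, c ≠ 0 → cnt (fun x => Q x = c) = cnt (fun x => Q x = 1)) :
    (p : ℚ) * cnt (fun x => Q x = 1 ∧ B γ x = 0) = p * cnt (fun x => Q x = 1)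
      + (cnt (fun x => Q x = 0) - cnt (fun x => Q x = 1)) *
        cnt (fun j : ZMod p => 1 + j ^ 2 * Q γ = 0)
      - Fintype.card V + (Fintype.card V : ℚ) / p := by
  classical
  have hp0 : (p : ℚ) ≠ 0 := by exact_mod_cast (Fact.out : p.Prime).ne_zero
  have h1 : cnt (fun z : V × ZMod p => Q z.1 = 1 + z.2 ^ 2 * Q γ) =
      p * cnt (fun x => Q x = 1)
      + (cnt (fun x => Q x = 0) - cnt (fun x => Q x = 1)) *
        cnt (fun j : ZMod p => 1 + j ^ 2 * Q γ = 0) := by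
    rw [cnt_prod_right, cnt_eq_sum (fun j : ZMod p => 1 + j ^ 2 * Q γ = 0), Finset.mul_sum]
    have : (p : ℚ) * cnt (fun x => Q x = 1) = ∑ j : ZMod p, cnt (fun x => Q x = 1) := by
      simp [ZMod.card]
    rw [this, ← Finset.sum_add_distrib]
    refine Finset.sum_congr rfl fun j _ => ?_
    by_cases h : 1 + j ^ 2 * Q γ = 0
    · simp only [h, if_true]; ring
    · simp only [h, if_false]; rw [hs _ h]; ring
  have h2 : cnt (fun z : V × ZMod p => Q z.1 = 1 + z.2 ^ 2 * Q γ) =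
      cnt (fun z : V × ZMod p => Q z.1 + z.2 * B γ z.1 = 1) := by
    symm
    refine cnt_equiv (⟨fun z => (z.1 + z.2 • γ, z.2), fun z => (z.1 - z.2 • γ, z.2),
        fun z => by simp, fun z => by simp⟩ : V × ZMod p ≃ V × ZMod p) fun z => ?_
    simp only [Equiv.coe_fn_mk, hQ, hBs, hQs]
    constructor
    · intro h; linear_combination h
    · intro h; linear_combination h
  have h3 : cnt (fun z : V × ZMod p => Q z.1 + z.2 * B γ z.1 = 1) =
      Fintype.card V - (Fintype.card V : ℚ) / p + p * cnt (fun x => Q x = 1 ∧ B γ x = 0) := by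
    have e1 : (Fintype.card V : ℚ) - (Fintype.card V : ℚ) / p = cnt (fun x => ¬ B γ x = 0) := by
      rw [cnt_not, cnt_hom (B γ) hB, ZMod.card]
    rw [e1, cnt_prod, cnt_eq_sum (fun x => ¬ B γ x = 0), cnt_eq_sum (fun x => Q x = 1 ∧ B γ x = 0),
      Finset.mul_sum, ← Finset.sum_add_distrib]
    refine Finset.sum_congr rfl fun x _ => ?_
    by_cases h : B γ x = 0
    · by_cases h' : Q x = 1
      · simp only [h, h', mul_zero, add_zero]; rw [cnt_true]; simp [ZMod.card]
      · simp only [h, h', mul_zero, add_zero]; rw [cnt_false (by simp)]; simp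
    · simp only [h, not_false_eq_true, if_true, and_false, if_false, mul_zero, add_zero]
      rw [cnt_congr (R := fun j => j = (1 - Q x) / B γ x)]
      · exact cnt_single _
      · intro j
        rw [eq_div_iff h]
        constructor
        · intro h; linear_combination h
        · intro h; linear_combination h
  rw [h2, h3] at h1
  linarith
section fld
variable {F : Type*} [Field F] [Fintype F] [Algebra (ZMod p) F] [CharP F p]

theorem trace_frob (k : ℕ) (x : F) :
    Algebra.trace (ZMod p) F (x ^ p ^ k) = Algebra.trace (ZMod p) F x := by
  induction k generalizing x with
  | zero => simp
  | succ k ih =>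
    rw [pow_succ, pow_mul]
    have := Algebra.trace_eq_of_algEquiv (FiniteField.frobeniusAlgEquivOfAlgebraic (ZMod p) F) (x ^ p ^ k)
    rw [← ih x, ← this]
    simp [ZMod.card]

theorem frob_iter (k : ℕ) (x : F) : (fun y : F => y ^ p)^[k] x = x ^ p ^ k := by
  induction k with
  | zero => simp
  | succ k ih => rw [Function.iterate_succ_apply', ih, pow_succ, pow_mul]

theorem frob_per (k n : ℕ) (x : F) (h : x ^ p ^ k = x) (hkn : k ∣ n) : x ^ p ^ n = x := by
  have h1 : Function.IsPeriodicPt (fun y : F => y ^ p) k x := by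
    rw [Function.IsPeriodicPt, Function.IsFixedPt, frob_iter, h]
  have := h1.trans_dvd hkn
  rwa [Function.IsPeriodicPt, Function.IsFixedPt, frob_iter] at this

theorem frob_gcd (k n : ℕ) (x : F) (h : x ^ p ^ k = x) (h' : x ^ p ^ n = x) :
    x ^ p ^ (Nat.gcd k n) = x := by
  have h1 : Function.IsPeriodicPt (fun y : F => y ^ p) k x := by
    rw [Function.IsPeriodicPt, Function.IsFixedPt, frob_iter, h]
  have h2 : Function.IsPeriodicPt (fun y : F => y ^ p) n x := by
    rw [Function.IsPeriodicPt, Function.IsFixedPt, frob_iter, h']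
  have := h1.gcd h2
  rwa [Function.IsPeriodicPt, Function.IsFixedPt, frob_iter] at this

theorem gcd_fact {l m s : ℕ} (hm : 1 ≤ m) (hs : s = Nat.gcd l (2 * m)) (hsm : s ∣ m)
    (hodd : Odd (m / s)) : Nat.gcd (4 * l) (2 * m) = 2 * s ∧ ∃ t, l = s * (2 * t + 1) := by
  have hs0 : 0 < s := Nat.pos_of_dvd_of_pos hsm hm
  obtain ⟨r, hr⟩ := hsm
  obtain ⟨t, ht⟩ : s ∣ l := hs ▸ Nat.gcd_dvd_left _ _
  have hrr : m / s = r := by rw [hr]; exact Nat.mul_div_cancel_left _ hs0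
  rw [hrr] at hodd
  have hc : Nat.Coprime t (2 * r) := by
    have : s * Nat.gcd t (2 * r) = s * 1 := by
      rw [← Nat.gcd_mul_left, mul_one, ← ht]
      have : s * (2 * r) = 2 * m := by rw [hr]; ring
      rw [this, ← hs]
    exact Nat.eq_of_mul_eq_mul_left hs0 this
  constructor
  · have : Nat.gcd (4 * l) (2 * m) = (2 * s) * Nat.gcd (2 * t) r := by
      rw [← Nat.gcd_mul_left, ht, hr]; congr 1 <;> ring
    rw [this]
    have : Nat.Coprime (2 * t) r := by
      refine Nat.Coprime.mul_left ?_ (Nat.Coprime.coprime_mul_left_right hc)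
      exact (Nat.coprime_two_left).2 hodd
    rw [this, mul_one]
  · have : Odd t := by
      have := Nat.Coprime.coprime_mul_right_right hc
      exact (Nat.coprime_two_right).1 this
    obtain ⟨k, hk⟩ := this
    exact ⟨k, by rw [← hk]; exact ht⟩

theorem ker_triv {l m s : ℕ} (hp2 : p ≠ 2) (hm : 1 ≤ m) (hs : s = Nat.gcd l (2 * m)) (hsm : s ∣ m)
    (hodd : Odd (m / s)) (hF : Fintype.card F = p ^ (2 * m)) (x : F)
    (hx : x ^ p ^ (2 * l) + x = 0) : x = 0 := by
  have h1 : x ^ p ^ (2 * l) = - x := by linear_combination hx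
  have h2 : x ^ p ^ (4 * l) = x := by
    have : 4 * l = 2 * l + 2 * l := by ring
    rw [this, pow_add, pow_mul, h1, Odd.neg_pow, h1, neg_neg]
    exact ((Fact.out : p.Prime).odd_of_ne_two hp2).pow
  have h3 : x ^ p ^ (2 * m) = x := by rw [← hF]; exact FiniteField.pow_card x
  have h4 := frob_gcd _ _ x h2 h3
  obtain ⟨hg, t, ht⟩ := gcd_fact hm hs hsm hodd
  rw [hg] at h4
  have h5 := frob_per _ (2 * l) x h4 ⟨2 * t + 1, by rw [ht]; ring⟩
  rw [h5] at h1
  have h6 : (2 : F) * x = 0 := by linear_combination h1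
  have : (2 : F) ≠ 0 := by
    apply Ring.two_ne_zero
    rw [ringChar.eq F p]; exact hp2
  exact (mul_eq_zero.1 h6).resolve_left this

theorem exU {l m s : ℕ} (hp2 : p ≠ 2) (hm : 1 ≤ m) (hs : s = Nat.gcd l (2 * m)) (hsm : s ∣ m)
    (hodd : Odd (m / s)) (hF : Fintype.card F = p ^ (2 * m)) (a : F) :
    ∃! γ : F, γ ^ p ^ (2 * l) + γ = a := by
  let f : F →+ F := (iterateFrobenius F p (2 * l)).toAddMonoidHom + AddMonoidHom.id F
  have hf : ∀ x, f x = x ^ p ^ (2 * l) + x := fun x => by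
    simp [f, iterateFrobenius_def]
  have hi : Function.Injective f := by
    rw [injective_iff_map_eq_zero]
    intro x hx
    rw [hf] at hx
    exact ker_triv hp2 hm hs hsm hodd hF x hx
  have hb : Function.Bijective f := ⟨hi, Finite.surjective_of_injective hi⟩
  have := hb.existsUnique a
  simpa only [hf] using this

/-- the quadratic form. -/
def QF (p : ℕ) [Fact p.Prime] (F : Type*) [Field F] [Algebra (ZMod p) F] (l : ℕ) (x : F) : ZMod p :=
  Algebra.trace (ZMod p) F (x ^ (p ^ l + 1))

/-- its polar form. -/
def BF (p : ℕ) [Fact p.Prime] (F : Type*) [Field F] [Algebra (ZMod p) F] [CharP F p] (l : ℕ) (v : F) :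
    F →+ ZMod p where
  toFun u := Algebra.trace (ZMod p) F (v ^ p ^ l * u + v * u ^ p ^ l)
  map_zero' := by simp [(Fact.out : p.Prime).ne_zero]
  map_add' x y := by
    rw [← map_add, add_pow_char_pow]; congr 1; ring

theorem BF_apply (l : ℕ) (v u : F) :
    BF p F l v u = Algebra.trace (ZMod p) F (v ^ p ^ l * u + v * u ^ p ^ l) := rfl

theorem QF_add (l : ℕ) (u v : F) : QF p F l (u + v) = QF p F l u + QF p F l v + BF p F l v u := by
  rw [BF_apply, QF, QF, QF, ← map_add, ← map_add, pow_succ, add_pow_char_pow]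
  congr 1; ring

theorem BF_eq (l : ℕ) (v u : F) :
    BF p F l v u = Algebra.trace (ZMod p) F ((v ^ p ^ (2 * l) + v) * u ^ p ^ l) := by
  rw [BF_apply, map_add, ← trace_frob l (v ^ p ^ l * u), ← map_add]
  congr 1
  rw [mul_pow, ← pow_mul, ← pow_add, two_mul]; ring

theorem zmod_frob (l : ℕ) (j : ZMod p) : j ^ p ^ l = j := by
  induction l with
  | zero => simp
  | succ k ih => rw [pow_succ, pow_mul, ih, ZMod.pow_card]

theorem BF_smul (l : ℕ) (v : F) (j : ZMod p) (u : F) : BF p F l (j • v) u = j * BF p F l v u := by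
  rw [BF_apply, BF_apply, ← smul_eq_mul (a := j), ← map_smul, smul_pow, zmod_frob]
  congr 1; simp [smul_add]

theorem QF_smul (l : ℕ) (v : F) (j : ZMod p) : QF p F l (j • v) = j ^ 2 * QF p F l v := by
  rw [QF, QF, ← smul_eq_mul, ← map_smul, smul_pow, pow_succ, zmod_frob, ← pow_two]

theorem QF_zero (l : ℕ) : QF p F l 0 = 0 := by simp [QF]

theorem trace_mul_surj (w : F) (hw : w ≠ 0) (c : ZMod p) :
    ∃ y : F, Algebra.trace (ZMod p) F (w * y) = c := by
  obtain ⟨y, hy⟩ := Algebra.trace_surjective (ZMod p) F c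
  exact ⟨w⁻¹ * y, by rw [mul_inv_cancel_left₀ hw, hy]⟩

theorem BF_surj {l m s : ℕ} (hp2 : p ≠ 2) (hm : 1 ≤ m) (hs : s = Nat.gcd l (2 * m)) (hsm : s ∣ m)
    (hodd : Odd (m / s)) (hF : Fintype.card F = p ^ (2 * m)) (v : F) (hv : v ≠ 0) :
    Function.Surjective (BF p F l v) := by
  intro c
  have hw : v ^ p ^ (2 * l) + v ≠ 0 := fun h => hv (ker_triv hp2 hm hs hsm hodd hF v h)
  obtain ⟨y, hy⟩ := trace_mul_surj _ hw c
  obtain ⟨u, hu⟩ := Finite.surjective_of_injective (iterateFrobenius_inj F p l) y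
  rw [iterateFrobenius_def] at hu
  exact ⟨u, by rw [BF_eq, hu, hy]⟩

theorem BF_gamma (l : ℕ) (a γ : F) (hγ : γ ^ p ^ (2 * l) + γ = -a ^ p ^ l) (x : F) :
    BF p F l γ x = - Algebra.trace (ZMod p) F (a * x) := by
  rw [BF_eq, hγ, neg_mul, map_neg, ← mul_pow, trace_frob]

theorem ex_lam {l m s : ℕ} (hm : 1 ≤ m) (hs : s = Nat.gcd l (2 * m)) (hsm : s ∣ m)
    (hodd : Odd (m / s)) (hF : Fintype.card F = p ^ (2 * m)) (z : ZMod p) (hz : z ≠ 0) :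
    ∃ y : F, y ≠ 0 ∧ y ^ (p ^ l + 1) = algebraMap (ZMod p) F z := by
  have hp1 : 1 < p := (Fact.out : p.Prime).one_lt
  have hs0 : 0 < s := Nat.pos_of_dvd_of_pos hsm hm
  obtain ⟨hg, t, ht⟩ := gcd_fact hm hs hsm hodd
  obtain ⟨g, hgen⟩ := IsCyclic.exists_generator (α := Fˣ)
  have hord : orderOf g = p ^ (2 * m) - 1 := by
    rw [orderOf_eq_card_of_forall_mem_zpowers hgen, Nat.card_units, Nat.card_eq_fintype_card, hF]
  have hzF : algebraMap (ZMod p) F z ≠ 0 := by simpa using hz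
  obtain ⟨k, hk⟩ := (mem_powers_iff_mem_zpowers.2 (hgen (Units.mk0 _ hzF)) : _ ∈ Submonoid.powers g)
  have hk : g ^ k = Units.mk0 _ hzF := hk
  have h2s : 2 * s ∣ 2 * m := Nat.mul_dvd_mul_left 2 hsm
  have hP1 : 1 < p ^ s := Nat.one_lt_pow hs0.ne' hp1
  obtain ⟨P, hP⟩ : ∃ P, p ^ s = P + 1 := ⟨p ^ s - 1, by omega⟩
  have hP0 : 0 < P := by omega
  obtain ⟨N, hN⟩ : p ^ (2 * s) - 1 ∣ p ^ (2 * m) - 1 := by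
    obtain ⟨r, hr⟩ := h2s
    rw [hr, pow_mul p (2 * s) r]; exact Nat.sub_one_dvd_pow_sub_one _ _
  have hPP : p ^ (2 * s) - 1 = P * (p ^ s + 1) := by
    rw [mul_comm 2 s, pow_mul, hP, Nat.sub_eq_of_eq_add]; ring
  have h1 : orderOf g ∣ k * P := by
    rw [orderOf_dvd_iff_pow_eq_one, pow_mul, hk]
    ext
    push_cast
    rw [Units.val_mk0, ← map_pow]
    have : z ^ P = 1 := by
      have h := zmod_frob s z
      rw [hP, pow_succ] at h
      exact mul_right_cancel₀ hz (by rw [h, one_mul])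
    rw [this, map_one]
  rw [hord, hN, hPP] at h1
  obtain ⟨k', hk'⟩ := h1
  have hkk : k = (N * k') * (p ^ s + 1) := by
    apply Nat.eq_of_mul_eq_mul_right hP0
    rw [hk']; ring
  have hy1 : (g ^ (N * k')) ^ (p ^ s + 1) = Units.mk0 _ hzF := by
    rw [← pow_mul, ← hkk, hk]
  have hy2 : (((g ^ (N * k') : Fˣ) : F)) ^ p ^ (2 * s) = ((g ^ (N * k') : Fˣ) : F) := by
    have : p ^ (2 * s) = (p ^ (2 * s) - 1) + 1 := by
      have : 0 < p ^ (2 * s) := by positivity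
      omega
    have h3 : (g ^ (N * k')) ^ (p ^ (2 * s) - 1) = 1 := by
      rw [← pow_mul, ← orderOf_dvd_iff_pow_eq_one, hord, hN]
      exact ⟨k', by ring⟩
    rw [this, pow_succ, ← Units.val_pow_eq_pow_val, h3]; simp
  refine ⟨((g ^ (N * k') : Fˣ) : F), Units.ne_zero _, ?_⟩
  have : p ^ l = p ^ (2 * s * t) * p ^ s := by rw [← pow_add, ht]; congr 1; ring
  rw [pow_succ, this, pow_mul, frob_per _ (2 * s * t) _ hy2 ⟨t, rfl⟩, ← pow_succ,
    ← Units.val_pow_eq_pow_val, hy1, Units.val_mk0]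

theorem QF_sim {l m s : ℕ} (hm : 1 ≤ m) (hs : s = Nat.gcd l (2 * m)) (hsm : s ∣ m)
    (hodd : Odd (m / s)) (hF : Fintype.card F = p ^ (2 * m)) (c : ZMod p) (hc : c ≠ 0) :
    cnt (fun x : F => QF p F l x = c) = cnt (fun x : F => QF p F l x = 1) := by
  obtain ⟨y, hy0, hy⟩ := ex_lam hm hs hsm hodd hF c hc
  symm
  refine cnt_equiv (Equiv.mulLeft₀ y hy0) fun x => ?_
  have : QF p F l (y * x) = c * QF p F l x := by
    rw [QF, QF, mul_pow, hy, ← Algebra.smul_def, map_smul, smul_eq_mul]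
  rw [show Equiv.mulLeft₀ y hy0 x = y * x from rfl, this]
  constructor
  · intro h; rw [h, mul_one]
  · intro h; exact mul_left_cancel₀ hc (by rw [h, mul_one])

theorem n1_dvd {l m s : ℕ} (hm : 1 ≤ m) (hs : s = Nat.gcd l (2 * m)) (hsm : s ∣ m)
    (hodd : Odd (m / s)) (hF : Fintype.card F = p ^ (2 * m)) :
    ∃ k : ℤ, cnt (fun x : F => QF p F l x = 1) = (p ^ s + 1 : ℚ) * k := by
  classical
  obtain ⟨hg, t, ht⟩ := gcd_fact hm hs hsm hodd
  have hp1 : 1 < p := (Fact.out : p.Prime).one_lt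
  obtain ⟨T, hT⟩ : p ^ s + 1 ∣ p ^ l + 1 := by
    have := Odd.nat_add_dvd_pow_add_pow (p ^ s) 1 (n := 2 * t + 1) ⟨t, rfl⟩
    rwa [← pow_mul, ← ht, one_pow] at this
  have hdq : p ^ s + 1 ∣ p ^ (2 * m) - 1 := by
    obtain ⟨r, hr⟩ := hsm
    have h1 : p ^ (2 * s) - 1 ∣ p ^ (2 * m) - 1 := by
      rw [hr, show 2 * (s * r) = 2 * s * r by ring, pow_mul p (2 * s) r]
      exact Nat.sub_one_dvd_pow_sub_one _ _
    refine dvd_trans ?_ h1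
    refine ⟨p ^ s - 1, ?_⟩
    rw [← Nat.sq_sub_sq, one_pow, ← pow_mul, mul_comm s 2]
  have h0 : cnt (fun x : F => QF p F l x = 1) = cnt (fun x : Fˣ => QF p F l (x : F) = 1) := by
    unfold cnt
    congr 1
    refine Nat.card_congr ⟨fun x => ⟨Units.mk0 x.1 ?_, x.2⟩, fun x => ⟨x.1, x.2⟩,
      fun x => rfl, fun x => ?_⟩
    · intro h
      have := x.2
      rw [h, QF_zero] at this
      exact zero_ne_one this
    · ext; rfl
  have hker : cnt (fun x : Fˣ => x ^ (p ^ s + 1) = 1) = p ^ s + 1 := by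
    have := IsCyclic.card_powMonoidHom_ker (G := Fˣ) (p ^ s + 1)
    rw [Nat.card_units, Nat.card_eq_fintype_card (α := F), hF, Nat.gcd_eq_right hdq] at this
    have h2 : cnt (fun x : Fˣ => x ^ (p ^ s + 1) = 1) =
      ((Nat.card (powMonoidHom (p ^ s + 1) : Fˣ →* Fˣ).ker : ℕ) : ℚ) := rfl
    rw [h2, this]; push_cast; rfl
  rw [h0, cnt_fib (fun x : Fˣ => x ^ (p ^ s + 1))]
  have key : ∀ w : Fˣ, ∃ k : ℤ,
      cnt (fun x : Fˣ => QF p F l (x : F) = 1 ∧ x ^ (p ^ s + 1) = w) = (p ^ s + 1 : ℚ) * k := by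
    intro w
    by_cases hw : ∃ x0 : Fˣ, QF p F l (x0 : F) = 1 ∧ x0 ^ (p ^ s + 1) = w
    · obtain ⟨x0, h1, h2⟩ := hw
      refine ⟨1, ?_⟩
      rw [Int.cast_one, mul_one, ← hker]
      symm
      refine cnt_equiv (Equiv.mulLeft x0) fun x => ?_
      simp only [Equiv.coe_mulLeft]
      constructor
      · intro h
        have h3 : (x0 * x) ^ (p ^ s + 1) = x0 ^ (p ^ s + 1) := by rw [mul_pow, h, mul_one]
        refine ⟨?_, by rw [h3, h2]⟩
        rw [← h1, QF, QF, hT, pow_mul, pow_mul, ← Units.val_pow_eq_pow_val, h3,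
          Units.val_pow_eq_pow_val]
      · rintro ⟨_, h⟩
        rw [mul_pow, h2] at h
        simpa using h
    · refine ⟨0, ?_⟩
      rw [cnt_false]
      · simp
      · intro x hx; exact hw ⟨x, hx⟩
  choose k hk using key
  refine ⟨∑ w, k w, ?_⟩
  push_cast
  rw [Finset.mul_sum]
  exact Finset.sum_congr rfl fun w _ => hk w

theorem n_vals {l m s : ℕ} (hp2 : p ≠ 2) (hm : 1 ≤ m) (hs : s = Nat.gcd l (2 * m)) (hsm : s ∣ m)
    (hodd : Odd (m / s)) (hF : Fintype.card F = p ^ (2 * m)) :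
    cnt (fun x : F => QF p F l x = 0) - cnt (fun x : F => QF p F l x = 1) = - (p : ℚ) ^ m ∧
    (p : ℚ) * cnt (fun x : F => QF p F l x = 1) = p ^ (2 * m) + p ^ m := by
  have hD := quad_D (QF p F l) (BF p F l) (QF_add l) (by ext u; simp [BF_eq, (Fact.out : p.Prime).ne_zero])
    (QF_zero l) (BF_surj hp2 hm hs hsm hodd hF) (QF_sim hm hs hsm hodd hF)
  have h1 : (Fintype.card F : ℚ) = cnt (fun x => QF p F l x = 0) + (p - 1) * cnt (fun x => QF p F l x = 1) := by
    rw [← cnt_true, cnt_fib (QF p F l)]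
    simp only [true_and]
    exact sum_off (fun c => cnt (fun x => QF p F l x = c)) (QF_sim hm hs hsm hodd hF)
  obtain ⟨k, hk⟩ := n1_dvd (F := F) (p := p) hm hs hsm hodd hF
  rw [hF] at hD h1
  generalize cnt (fun x => QF p F l x = 0) = n0 at *
  generalize cnt (fun x => QF p F l x = 1) = n1 at *
  push_cast at hD h1
  have hDD : n0 - n1 = - (p : ℚ) ^ m := by
    have : (n0 - n1) ^ 2 = ((p : ℚ) ^ m) ^ 2 := by rw [hD]; ring
    rcases sq_eq_sq_iff_eq_or_eq_neg.1 this with h | h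
    · exfalso
      have h2 : (p : ℚ) ^ m * (p ^ m - 1) = (p ^ s + 1) * (p * k) := by
        have : (p : ℚ) ^ (2 * m) = p ^ m * p ^ m := by rw [two_mul, pow_add]
        rw [this] at h1
        rw [hk] at h1 h
        linear_combination h1 + h
      have h3 : (p : ℤ) ^ m * (p ^ m - 1) = (p ^ s + 1) * (p * k) := by exact_mod_cast h2
      have h4 : (p : ℤ) ^ s + 1 ∣ (p : ℤ) ^ m + 1 := by
        obtain ⟨r, hr⟩ := hsm
        have hs0 : 0 < s := Nat.pos_of_ne_zero (by rintro rfl; simp at hr; omega)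
        have hrr : m / s = r := by rw [hr]; exact Nat.mul_div_cancel_left _ hs0
        rw [hrr] at hodd
        have := Odd.add_dvd_pow_add_pow ((p : ℤ) ^ s) 1 hodd
        rwa [one_pow, ← pow_mul, ← hr] at this
      have h5 : (p : ℤ) ^ s + 1 ∣ 2 := by
        have ha : (p : ℤ) ^ s + 1 ∣ (p : ℤ) ^ m * (p ^ m - 1) := ⟨_, h3⟩
        have hb : (2 : ℤ) = (p : ℤ) ^ m * (p ^ m - 1) - (p ^ m + 1) * (p ^ m - 2) := by ring
        rw [hb]
        exact dvd_sub ha (h4.mul_right _)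
      have h6 := Int.le_of_dvd (by norm_num) h5
      have hs0 : s ≠ 0 := by
        rintro rfl
        have := Nat.eq_zero_of_zero_dvd hsm
        omega
      have hP1 : 1 < p ^ s := Nat.one_lt_pow hs0 (Fact.out : p.Prime).one_lt
      have : (1 : ℤ) < (p : ℤ) ^ s := by exact_mod_cast hP1
      omega
    · exact h
  refine ⟨hDD, ?_⟩
  linear_combination -h1 - hDD

theorem cnt_mul {A B : Type*} [Fintype A] [Fintype B] (P : A → Prop) (R : B → Prop) :
    cnt (fun z : A × B => P z.1 ∧ R z.2) = cnt P * cnt R := by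
  classical
  rw [cnt_prod, cnt_eq_sum P, Finset.sum_mul]
  refine Finset.sum_congr rfl fun x _ => ?_
  by_cases h : P x
  · simp [h]
  · simp only [h, false_and, if_false, zero_mul]; exact cnt_false (by simp)

theorem half {A : Type*} [Fintype A] (C : ZMod p → Prop) (hC0 : ¬ C 0)
    (hC : ∀ c, c ≠ 0 → (C (-c) ↔ ¬ C c)) (P : A → Prop) (f : A → ZMod p) (σ : A ≃ A)
    (hP : ∀ x, P x ↔ P (σ x)) (hf : ∀ x, f (σ x) = - f x) :
    2 * cnt (fun x => P x ∧ C (f x)) = cnt (fun x => P x ∧ f x ≠ 0) := by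
  rw [cnt_and_not (fun x => P x ∧ f x ≠ 0) (fun x => C (f x))]
  have h1 : cnt (fun x => (P x ∧ f x ≠ 0) ∧ C (f x)) = cnt (fun x => P x ∧ C (f x)) := by
    refine cnt_congr fun x => ⟨fun h => ⟨h.1.1, h.2⟩, fun h => ⟨⟨h.1, fun h0 => ?_⟩, h.2⟩⟩
    rw [h0] at h; exact hC0 h.2
  have h2 : cnt (fun x => (P x ∧ f x ≠ 0) ∧ ¬ C (f x)) = cnt (fun x => P x ∧ C (f x)) := by
    refine cnt_equiv σ fun x => ?_
    rw [hf, ← hP]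
    by_cases h0 : f x = 0
    · simp [h0, hC0]
    · simp [h0, hC _ h0]
  rw [h1, h2]; ring

theorem cnt_C (C : ZMod p → Prop) (hC0 : ¬ C 0)
    (hC : ∀ c, c ≠ 0 → (C (-c) ↔ ¬ C c)) : cnt C = ((p : ℚ) - 1) / 2 := by
  have h := half C hC0 hC (fun _ => True) id (Equiv.neg _) (fun _ => Iff.rfl) (fun _ => rfl)
  simp only [true_and, id] at h
  have h2 := cnt_not (fun x : ZMod p => x = 0)
  rw [cnt_single, ZMod.card] at h2
  have h3 : cnt (fun x : ZMod p => x ≠ 0) = p - 1 := h2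
  rw [h3] at h
  have h4 : cnt C = cnt (fun x => C x) := rfl
  linarith

/-- counting with a surjective homomorphism to `ZMod p × W`. -/
theorem cnt_C_hom {A W : Type*} [AddCommGroup A] [Fintype A] [AddCommGroup W] [Fintype W]
    (C : ZMod p → Prop) (hC0 : ¬ C 0) (hC : ∀ c, c ≠ 0 → (C (-c) ↔ ¬ C c))
    (f : A →+ ZMod p × W) (hf : Function.Surjective f) (w : W) :
    cnt (fun x => C (f x).1 ∧ (f x).2 = w) =
      ((p : ℚ) - 1) / 2 * (Fintype.card A / (p * Fintype.card W)) := by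
  classical
  rw [cnt_fib (fun x => (f x).1), ← cnt_C C hC0 hC, cnt_eq_sum C, Finset.sum_mul]
  refine Finset.sum_congr rfl fun c _ => ?_
  by_cases h : C c
  · rw [if_pos h, one_mul, cnt_congr (R := fun x => f x = (c, w)), cnt_hom f hf]
    · simp [Fintype.card_prod, ZMod.card]
    · intro x
      rw [Prod.ext_iff]
      constructor
      · rintro ⟨⟨_, h2⟩, h3⟩; exact ⟨h3, h2⟩
      · rintro ⟨h1, h2⟩; exact ⟨⟨by rw [h1]; exact h, h2⟩, h1⟩
  · rw [if_neg h, zero_mul]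
    refine cnt_false ?_
    rintro x ⟨⟨h1, _⟩, h3⟩
    rw [h3] at h1; exact h h1

theorem tr_pair_surj (b : F) (hb : b ∉ Set.range (algebraMap (ZMod p) F)) :
    Function.Surjective (((Algebra.trace (ZMod p) F).toAddMonoidHom).prod
      ((Algebra.trace (ZMod p) F).toAddMonoidHom.comp (AddMonoidHom.mulLeft b))) := by
  obtain ⟨y0, hy0⟩ := Algebra.trace_surjective (ZMod p) F 1
  have h1 : ∃ x1 : F, Algebra.trace (ZMod p) F x1 = 0 ∧ Algebra.trace (ZMod p) F (b * x1) ≠ 0 := by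
    by_contra! hcon
    apply hb
    refine ⟨Algebra.trace (ZMod p) F (b * y0), ?_⟩
    by_contra hne
    have hne' : b - algebraMap (ZMod p) F (Algebra.trace (ZMod p) F (b * y0)) ≠ 0 :=
      fun h => hne (sub_eq_zero.1 h).symm
    obtain ⟨x, hx⟩ := trace_mul_surj (p := p) _ hne' 1
    have h2 := hcon (x - (Algebra.trace (ZMod p) F x) • y0)
      (by rw [map_sub, map_smul, hy0]; simp)
    rw [mul_sub, mul_smul_comm, map_sub, map_smul] at h2
    rw [sub_mul, map_sub, ← Algebra.smul_def, map_smul] at hx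
    simp only [smul_eq_mul] at h2 hx
    exact zero_ne_one (α := ZMod p) (by rw [← hx, ← h2]; ring)
  obtain ⟨x1, hx1, hx2⟩ := h1
  rintro ⟨c, c'⟩
  refine ⟨c • y0 + ((c' - c * Algebra.trace (ZMod p) F (b * y0)) / Algebra.trace (ZMod p) F (b * x1)) • x1, ?_⟩
  ext
  · simp [hy0, hx1]
  · simp [mul_add, hx2]


theorem cnt_Ctr (C : ZMod p → Prop) (hC0 : ¬ C 0)
    (hC : ∀ c, c ≠ 0 → (C (-c) ↔ ¬ C c)) : cnt (fun y : F => C (Algebra.trace (ZMod p) F y)) =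
    ((p : ℚ) - 1) / 2 * (Fintype.card F / p) := by
  have h := cnt_C_hom (W := Unit) C hC0 hC
    ((Algebra.trace (ZMod p) F).toAddMonoidHom.prod (0 : F →+ Unit))
    (by
      rintro ⟨c, ⟨⟩⟩
      obtain ⟨y, hy⟩ := Algebra.trace_surjective (ZMod p) F c
      exact ⟨y, by ext; simpa using hy⟩) ()
  simpa using h

theorem case_b0 (C : ZMod p → Prop) (hC0 : ¬ C 0)
    (hC : ∀ c, c ≠ 0 → (C (-c) ↔ ¬ C c)) (l : ℕ) (a : F) : cnt (fun z : F × F => QF p F l z.1 = 1 ∧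
      C (Algebra.trace (ZMod p) F z.2) ∧ Algebra.trace (ZMod p) F (a * z.1 + 0 * z.2) = 0) =
    cnt (fun x => QF p F l x = 1 ∧ Algebra.trace (ZMod p) F (a * x) = 0) *
      (((p : ℚ) - 1) / 2 * (Fintype.card F / p)) := by
  rw [← cnt_Ctr C hC0 hC, ← cnt_mul]
  refine cnt_congr fun z => ?_
  simp only [zero_mul, add_zero]; tauto

theorem case_bF (C : ZMod p → Prop) (hC0 : ¬ C 0)
    (hC : ∀ c, c ≠ 0 → (C (-c) ↔ ¬ C c)) (l : ℕ) (a : F) (b : ZMod p) (hb : b ≠ 0) :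
    cnt (fun z : F × F => QF p F l z.1 = 1 ∧
      C (Algebra.trace (ZMod p) F z.2) ∧
      Algebra.trace (ZMod p) F (a * z.1 + algebraMap (ZMod p) F b * z.2) = 0) =
    cnt (fun x => QF p F l x = 1 ∧ Algebra.trace (ZMod p) F (a * x) ≠ 0) *
      (Fintype.card F / (2 * p)) := by
  classical
  have h := half C hC0 hC (fun x : F => QF p F l x = 1)
    (fun x => - Algebra.trace (ZMod p) F (a * x) / b) (Equiv.neg F)
    (fun x => by
      have := QF_smul l x (-1 : ZMod p)
      simp only [neg_smul, one_smul, neg_one_sq, one_mul] at this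
      simp [this]) (fun x => by simp [neg_div])
  have h2 : cnt (fun x => QF p F l x = 1 ∧ - Algebra.trace (ZMod p) F (a * x) / b ≠ 0) =
      cnt (fun x => QF p F l x = 1 ∧ Algebra.trace (ZMod p) F (a * x) ≠ 0) := by
    refine cnt_congr fun x => ?_
    simp [hb]
  rw [h2] at h
  rw [← h, cnt_prod, cnt_eq_sum (fun x => QF p F l x = 1 ∧ C (- Algebra.trace (ZMod p) F (a * x) / b)),
    Finset.mul_sum, Finset.sum_mul]
  refine Finset.sum_congr rfl fun x _ => ?_
  have e1 : ∀ y, Algebra.trace (ZMod p) F (a * x + algebraMap (ZMod p) F b * y) = 0 ↔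
      Algebra.trace (ZMod p) F y = - Algebra.trace (ZMod p) F (a * x) / b := by
    intro y
    rw [map_add, ← Algebra.smul_def, map_smul, smul_eq_mul, eq_div_iff hb]
    constructor
    · intro h; linear_combination h
    · intro h; linear_combination h
  by_cases hx : QF p F l x = 1 ∧ C (- Algebra.trace (ZMod p) F (a * x) / b)
  · rw [if_pos hx, cnt_congr (R := fun y => Algebra.trace (ZMod p) F y =
      - Algebra.trace (ZMod p) F (a * x) / b)]
    · have := cnt_hom (Algebra.trace (ZMod p) F).toAddMonoidHom
        (Algebra.trace_surjective (ZMod p) F) (- Algebra.trace (ZMod p) F (a * x) / b)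
      rw [ZMod.card] at this
      refine Eq.trans this ?_
      have hp0 : (p : ℚ) ≠ 0 := by exact_mod_cast (Fact.out : p.Prime).ne_zero
      field_simp
    · intro y
      simp only [e1]
      constructor
      · exact fun h => h.2.2
      · intro h; exact ⟨hx.1, by rw [h]; exact hx.2, h⟩
  · rw [if_neg hx, mul_zero, zero_mul]
    refine cnt_false fun y hy => hx ?_
    simp only [e1] at hy
    exact ⟨hy.1, by rw [← hy.2.2]; exact hy.2.1⟩

theorem case_bN (C : ZMod p → Prop) (hC0 : ¬ C 0)
    (hC : ∀ c, c ≠ 0 → (C (-c) ↔ ¬ C c)) (l : ℕ) (a b : F) (hb : b ∉ Set.range (algebraMap (ZMod p) F)) :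
    cnt (fun z : F × F => QF p F l z.1 = 1 ∧
      C (Algebra.trace (ZMod p) F z.2) ∧
      Algebra.trace (ZMod p) F (a * z.1 + b * z.2) = 0) =
    cnt (fun x => QF p F l x = 1) * (((p : ℚ) - 1) / 2 * (Fintype.card F / (p * p))) := by
  classical
  rw [cnt_prod, cnt_eq_sum (fun x => QF p F l x = 1), Finset.sum_mul]
  refine Finset.sum_congr rfl fun x _ => ?_
  by_cases hx : QF p F l x = 1
  · rw [if_pos hx, one_mul]
    have := cnt_C_hom C hC0 hC _ (tr_pair_surj b hb) (- Algebra.trace (ZMod p) F (a * x))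
    rw [ZMod.card] at this
    rw [← this]
    refine cnt_congr fun y => ?_
    simp [hx, eq_neg_iff_add_eq_zero, add_comm]
  · rw [if_neg hx, zero_mul]
    exact cnt_false fun y hy => hx hy.1


theorem J_vals (hp : p % 4 = 3) (d : ZMod p) :
    ((d = 0 ∨ IsSquare d) → cnt (fun j : ZMod p => 1 + j ^ 2 * d = 0) = 0) ∧
    (¬ IsSquare d → cnt (fun j : ZMod p => 1 + j ^ 2 * d = 0) = 2) := by
  classical
  have hp2 : p ≠ 2 := by rintro rfl; omega
  have hneg : ¬ IsSquare (-1 : ZMod p) := by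
    rw [ZMod.exists_sq_eq_neg_one_iff]; simpa using hp
  constructor
  · rintro (h | ⟨r, hr⟩)
    · exact cnt_false (by simp [h])
    · refine cnt_false fun j hj => hneg ⟨j * r, ?_⟩
      rw [hr] at hj; linear_combination -hj
  · intro h
    have hd0 : d ≠ 0 := by rintro rfl; exact h ⟨0, by simp⟩
    have hq : IsSquare (-d) := by
      have hF : ringChar (ZMod p) ≠ 2 := by rw [ZMod.ringChar_zmod_n]; exact hp2
      rw [← quadraticChar_one_iff_isSquare (neg_ne_zero.2 hd0), ← neg_one_mul, map_mul,
        (quadraticChar_neg_one_iff_not_isSquare).2 h,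
        (quadraticChar_neg_one_iff_not_isSquare).2 hneg]
      rfl
    obtain ⟨r, hr⟩ := hq
    have hr0 : r ≠ 0 := by rintro rfl; simp at hr; exact hd0 hr
    have hne : r⁻¹ ≠ - r⁻¹ := by
      intro hh
      have h2 : (2 : ZMod p) * r⁻¹ = 0 := by linear_combination hh
      have : (2 : ZMod p) ≠ 0 := by
        apply Ring.two_ne_zero; rw [ZMod.ringChar_zmod_n]; exact hp2
      exact (mul_ne_zero this (inv_ne_zero hr0)) h2
    rw [cnt_congr (R := fun j => j ∈ ({r⁻¹, - r⁻¹} : Finset (ZMod p)))]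
    · unfold cnt
      rw [Nat.card_eq_fintype_card, Fintype.card_coe, Finset.card_pair hne]; norm_num
    · intro j
      rw [Finset.mem_insert, Finset.mem_singleton, ← sq_eq_sq_iff_eq_or_eq_neg, inv_pow,
        ← mul_eq_one_iff_eq_inv₀ (pow_ne_zero 2 hr0)]
      constructor
      · intro h; linear_combination -h - j ^ 2 * hr
      · intro h; linear_combination -h - j ^ 2 * hr

end fld
end helpers

section cycl
variable {p : ℕ} [Fact p.Prime]

theorem mem_cyc (i : ℕ) (x : ZMod p) :
    x ∈ cyc p i ↔ x ≠ 0 ∧ (if i = 0 then IsSquare x else ¬ IsSquare x) := by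
  classical
  simp [cyc]

theorem sq_neg (hp : p % 4 = 3) (c : ZMod p) (hc : c ≠ 0) : IsSquare (-c) ↔ ¬ IsSquare c := by
  have hneg : ¬ IsSquare (-1 : ZMod p) := by
    rw [ZMod.exists_sq_eq_neg_one_iff]; simpa using hp
  rw [← quadraticChar_one_iff_isSquare (neg_ne_zero.2 hc),
    ← quadraticChar_neg_one_iff_not_isSquare, ← neg_one_mul, map_mul,
    (quadraticChar_neg_one_iff_not_isSquare).2 hneg]
  constructor
  · intro h; linarith
  · intro h; linarith

theorem cyc_neg (hp : p % 4 = 3) (i : ℕ) (c : ZMod p) (hc : c ≠ 0) :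
    -c ∈ cyc p i ↔ ¬ c ∈ cyc p i := by
  rw [mem_cyc, mem_cyc]
  by_cases hi : i = 0
  · simp [hi, hc, sq_neg hp c hc]
  · simp [hi, hc, sq_neg hp c hc]

theorem cyc_zero (i : ℕ) : ¬ (0 : ZMod p) ∈ cyc p i := by simp [mem_cyc]

end cycl

/-- the values of `T_i(a,b)` when `m/s` is odd (paper Lemma 15). -/
theorem Tcount_eval_odd (p e l m s : ℕ) [Fact p.Prime] (hp : p % 4 = 3)
    (hl : 0 < l) (hm : 1 ≤ m) (he : e = 2 * m) (hs : s = Nat.gcd l e)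
    (hsm : s ∣ m) (hodd : Odd (m / s)) :
    ∀ i ≤ 1, ∀ a b : GaloisField p e,
      (a = 0 → b = 0 →
        (Tcount p e l i a b : ℚ) =
          ((p : ℚ) - 1) / 2 * ((p : ℚ) ^ (2 * e - 2) + (p : ℚ) ^ (e + m - 2))) ∧
      (a = 0 → b ≠ 0 → b ∈ Set.range (algebraMap (ZMod p) (GaloisField p e)) →
        Tcount p e l i a b = 0) ∧
      (a = 0 → b ≠ 0 → b ∉ Set.range (algebraMap (ZMod p) (GaloisField p e)) →
        (Tcount p e l i a b : ℚ) =
          ((p : ℚ) - 1) / 2 * ((p : ℚ) ^ (2 * e - 3) + (p : ℚ) ^ (e + m - 3))) ∧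
      (a ≠ 0 → b = 0 →
        (∃! γ : GaloisField p e, γ ^ p ^ (2 * l) + γ = -a ^ p ^ l) ∧
        ∀ γ : GaloisField p e, γ ^ p ^ (2 * l) + γ = -a ^ p ^ l →
          ((tr p e (γ ^ (p ^ l + 1)) = 0 ∨ tr p e (γ ^ (p ^ l + 1)) ∈ cyc p 0) →
            (Tcount p e l i a b : ℚ) =
              ((p : ℚ) - 1) / 2 * ((p : ℚ) ^ (2 * e - 3) + (p : ℚ) ^ (e + m - 2))) ∧
          (tr p e (γ ^ (p ^ l + 1)) ∈ cyc p 1 →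
            (Tcount p e l i a b : ℚ) =
              ((p : ℚ) - 1) / 2 * ((p : ℚ) ^ (2 * e - 3) - (p : ℚ) ^ (e + m - 2)))) ∧
      (a ≠ 0 → b ≠ 0 → b ∈ Set.range (algebraMap (ZMod p) (GaloisField p e)) →
        ∀ γ : GaloisField p e, γ ^ p ^ (2 * l) + γ = -a ^ p ^ l →
          ((tr p e (γ ^ (p ^ l + 1)) = 0 ∨ tr p e (γ ^ (p ^ l + 1)) ∈ cyc p 0) →
            (Tcount p e l i a b : ℚ) = ((p : ℚ) - 1) / 2 * (p : ℚ) ^ (2 * e - 3)) ∧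
          (tr p e (γ ^ (p ^ l + 1)) ∈ cyc p 1 →
            (Tcount p e l i a b : ℚ) =
              ((p : ℚ) - 1) / 2 * (p : ℚ) ^ (2 * e - 3) + (p : ℚ) ^ (e + m - 2))) ∧
      (a ≠ 0 → b ≠ 0 → b ∉ Set.range (algebraMap (ZMod p) (GaloisField p e)) →
        (Tcount p e l i a b : ℚ) =
          ((p : ℚ) - 1) / 2 * ((p : ℚ) ^ (2 * e - 3) + (p : ℚ) ^ (e + m - 3))) := by
  classical
  intro i _ a b
  have hp2 : p ≠ 2 := by rintro rfl; omega
  subst he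
  letI : Fintype (GaloisField p (2 * m)) := Fintype.ofFinite _
  have hF : Fintype.card (GaloisField p (2 * m)) = p ^ (2 * m) := by
    rw [← Nat.card_eq_fintype_card]; exact GaloisField.card p _ (by omega)
  have hp0 : (p : ℚ) ≠ 0 := by exact_mod_cast (Fact.out : p.Prime).ne_zero
  have hFQ : (Fintype.card (GaloisField p (2 * m)) : ℚ) = (p : ℚ) ^ (2 * m) := by
    rw [hF]; push_cast; rfl
  obtain ⟨hD, hN⟩ := n_vals (F := GaloisField p (2 * m)) (p := p) (l := l) hp2 hm hs hsm hodd hF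
  have hT : (Tcount p (2 * m) l i a b : ℚ) =
      cnt (fun z : GaloisField p (2 * m) × GaloisField p (2 * m) =>
        QF p (GaloisField p (2 * m)) l z.1 = 1 ∧
        (fun c => c ∈ cyc p i) (Algebra.trace (ZMod p) (GaloisField p (2 * m)) z.2) ∧
        Algebra.trace (ZMod p) (GaloisField p (2 * m)) (a * z.1 + b * z.2) = 0) := rfl
  have hC0 := cyc_zero (p := p) i
  have hC := cyc_neg hp i
  obtain ⟨k, rfl⟩ : ∃ k, m = k + 1 := ⟨m - 1, by omega⟩
  have e1 : 2 * (2 * (k + 1)) - 2 = 4 * k + 2 := by omega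
  have e2 : 2 * (k + 1) + (k + 1) - 2 = 3 * k + 1 := by omega
  have e3 : 2 * (2 * (k + 1)) - 3 = 4 * k + 1 := by omega
  have e4 : 2 * (k + 1) + (k + 1) - 3 = 3 * k := by omega
  rw [e1, e2, e3, e4]
  have hN1 : cnt (fun x : GaloisField p (2 * (k + 1)) => QF p (GaloisField p (2 * (k + 1))) l x = 1) =
      (p : ℚ) ^ (2 * k + 1) + (p : ℚ) ^ k := by
    apply mul_left_cancel₀ hp0
    rw [hN]; ring
  have hH : ∀ γ : GaloisField p (2 * (k + 1)), a ≠ 0 → γ ^ p ^ (2 * l) + γ = -a ^ p ^ l →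
      cnt (fun x => QF p (GaloisField p (2 * (k + 1))) l x = 1 ∧
        Algebra.trace (ZMod p) (GaloisField p (2 * (k + 1))) (a * x) = 0) =
      (p : ℚ) ^ (2 * k) + (p : ℚ) ^ k *
        (1 - cnt (fun j : ZMod p => 1 + j ^ 2 * QF p (GaloisField p (2 * (k + 1))) l γ = 0)) := by
    intro γ ha hγ
    have hγ0 : γ ≠ 0 := by
      rintro rfl
      rw [zero_pow (pow_ne_zero _ (Fact.out : p.Prime).ne_zero), add_zero] at hγ
      exact ha (eq_zero_of_pow_eq_zero (neg_eq_zero.1 hγ.symm))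
    have h := quad_h (QF p (GaloisField p (2 * (k + 1))) l) (BF p (GaloisField p (2 * (k + 1))) l)
      (QF_add l) (BF_smul l) (QF_smul l) γ (BF_surj hp2 hm hs hsm hodd hF γ hγ0)
      (QF_sim hm hs hsm hodd hF)
    simp only [BF_gamma l a γ hγ, neg_eq_zero] at h
    rw [hD, hN1, hFQ] at h
    apply mul_left_cancel₀ hp0
    rw [h]
    generalize cnt (fun j : ZMod p => 1 + j ^ 2 * QF p (GaloisField p (2 * (k + 1))) l γ = 0) = J
    field_simp
    ring
  have hJ0 : ∀ γ : GaloisField p (2 * (k + 1)),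
      (tr p (2 * (k + 1)) (γ ^ (p ^ l + 1)) = 0 ∨ tr p (2 * (k + 1)) (γ ^ (p ^ l + 1)) ∈ cyc p 0) →
      cnt (fun j : ZMod p => 1 + j ^ 2 * QF p (GaloisField p (2 * (k + 1))) l γ = 0) = 0 := by
    intro γ h
    refine (J_vals hp _).1 (h.imp id fun h => ?_)
    rw [mem_cyc] at h
    have h2 := h.2
    rw [if_pos rfl] at h2
    exact h2
  have hJ2 : ∀ γ : GaloisField p (2 * (k + 1)), tr p (2 * (k + 1)) (γ ^ (p ^ l + 1)) ∈ cyc p 1 →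
      cnt (fun j : ZMod p => 1 + j ^ 2 * QF p (GaloisField p (2 * (k + 1))) l γ = 0) = 2 := by
    intro γ h
    refine (J_vals hp _).2 ?_
    rw [mem_cyc] at h
    have h2 := h.2
    rw [if_neg one_ne_zero] at h2
    exact h2
  have hZ : cnt (fun x => QF p (GaloisField p (2 * (k + 1))) l x = 1 ∧
        Algebra.trace (ZMod p) (GaloisField p (2 * (k + 1))) (a * x) ≠ 0) =
      (p : ℚ) ^ (2 * k + 1) + (p : ℚ) ^ k -
      cnt (fun x => QF p (GaloisField p (2 * (k + 1))) l x = 1 ∧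
        Algebra.trace (ZMod p) (GaloisField p (2 * (k + 1))) (a * x) = 0) := by
    rw [← hN1, cnt_and_not (fun x => QF p (GaloisField p (2 * (k + 1))) l x = 1) (fun x =>
      Algebra.trace (ZMod p) (GaloisField p (2 * (k + 1))) (a * x) = 0)]
    ring
  refine ⟨?_, ?_, ?_, ?_, ?_, ?_⟩
  · rintro rfl rfl
    rw [hT, case_b0 _ hC0 hC, hFQ]
    simp only [zero_mul, map_zero, and_true]
    rw [hN1]
    field_simp; ring
  · rintro rfl hb ⟨b0, rfl⟩
    have hb0 : b0 ≠ 0 := by rintro rfl; simp at hb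
    have : (Tcount p (2 * (k + 1)) l i 0 (algebraMap (ZMod p) _ b0) : ℚ) = 0 := by
      rw [hT, case_bF _ hC0 hC _ _ _ hb0, cnt_false (by simp), zero_mul]
    exact_mod_cast this
  · rintro rfl _ hb
    rw [hT, case_bN _ hC0 hC _ _ _ hb, hFQ, hN1]
    field_simp; ring
  · rintro ha rfl
    refine ⟨exU hp2 hm hs hsm hodd hF _, fun γ hγ => ⟨fun h => ?_, fun h => ?_⟩⟩
    · rw [hT, case_b0 _ hC0 hC, hH γ ha hγ, hJ0 γ h, hFQ]
      field_simp; ring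
    · rw [hT, case_b0 _ hC0 hC, hH γ ha hγ, hJ2 γ h, hFQ]
      field_simp; ring
  · rintro ha hb ⟨b0, rfl⟩ γ hγ
    have hb0 : b0 ≠ 0 := by rintro rfl; simp at hb
    refine ⟨fun h => ?_, fun h => ?_⟩
    · rw [hT, case_bF _ hC0 hC _ _ _ hb0, hZ, hH γ ha hγ, hJ0 γ h, hFQ]
      field_simp; ring
    · rw [hT, case_bF _ hC0 hC _ _ _ hb0, hZ, hH γ ha hγ, hJ2 γ h, hFQ]
      field_simp; ring
  · rintro _ _ hb
    rw [hT, case_bN _ hC0 hC _ _ _ hb, hFQ, hN1]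
    field_simp; ring


end
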